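/- Let r ≥ 2 be an integer. Let C be a full subcategory of ERst_srq(r) such that for every finite chain L there is an object in Ob(C) isomorphic to r ⊗ L. Then C has the dual Ramsey property. In particular, ERst_srq(r) has the dual Ramsey property. -/

import Mathlib

open scoped Classical

noncomputable section

/-! ### Basic notions: anti-lexicographic order, types, matrices,
special anti-lexicographic order, rigid surjections -/

/-- `altLex X Y` : the anti-lexicographic order `⊏_alex` on subsets of a chain,
comparing characteristic vectors anti-lexicographically (`0 < 1`), i.e. the
`⊏`-largest element on which `X` and `Y` differ belongs to `Y`. -/
def altLex {A : Type*} [LinearOrder A] (X Y : Finset A) : Prop :=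
  ∃ m, m ∈ Y ∧ m ∉ X ∧ ∀ z, m < z → (z ∈ X ↔ z ∈ Y)

/-- The `≡_σ`-equivalence class of `i` within `{0, …, n-1}`, for a
(total quasi)order `σ` on `{0, …, n-1}`. -/
def classOf (σ : ℕ → ℕ → Prop) (n i : ℕ) : Finset ℕ :=
  (Finset.range n).filter fun j => σ i j ∧ σ j i

/-- The set of `≡_σ`-equivalence classes. -/
def classesOf (σ : ℕ → ℕ → Prop) (n : ℕ) : Finset (Finset ℕ) :=
  (Finset.range n).image (classOf σ n)

/-- `σ ◁ τ` : the linear order on total quasiorders on `{0, …, n-1}` : `σ ◁ τ` if `σ`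
has fewer classes, or they have equally many classes and the tuples of classes, each
listed in `<_alex`-increasing order, compare anti-lexicographically w.r.t. `<_alex`
(for such increasing enumerations of two families of sets this amounts to: the
`<_alex`-largest class in which the two families differ belongs to the family of
classes of `τ`). -/
def quasiLT (n : ℕ) (σ τ : ℕ → ℕ → Prop) : Prop :=
  (classesOf σ n).card < (classesOf τ n).card ∨
    ((classesOf σ n).card = (classesOf τ n).card ∧
      ∃ M, M ∈ classesOf τ n ∧ M ∉ classesOf σ n ∧
        ∀ X, altLex M X → (X ∈ classesOf σ n ↔ X ∈ classesOf τ n))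

/-- `IsTotalQuasiorder n σ` : `σ` is a total quasiorder on `{0, …, n-1}`. -/
def IsTotalQuasiorder (n : ℕ) (σ : ℕ → ℕ → Prop) : Prop :=
  (∀ i j, σ i j → i < n ∧ j < n) ∧ (∀ i < n, σ i i) ∧
    (∀ i j k, σ i j → σ j k → σ i k) ∧ ∀ i j, i < n → j < n → σ i j ∨ σ j i

/-- The type `tp(ā)` of a tuple (represented as a list): the total quasiorder
`{(i,j) : a_i ⊑ a_j}` on the set of positions of the list. -/
def tpRel {A : Type*} [LinearOrder A] (l : List A) : ℕ → ℕ → Prop :=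
  fun i j => ∃ (hi : i < l.length) (hj : j < l.length), l.get ⟨i, hi⟩ ≤ l.get ⟨j, hj⟩

/-- The special anti-lexicographic order `⊏_sal` on tuples (represented as lists):
`ā ⊏_sal b̄` iff `tp(ā) ◁ tp(b̄)`, or the types coincide, the sets of entries
differ and the set of entries of `ā` is `⊏_alex`-below that of `b̄`. -/
def salLT {A : Type*} [LinearOrder A] (l₁ l₂ : List A) : Prop :=
  l₁.length = l₂.length ∧
    (quasiLT l₁.length (tpRel l₁) (tpRel l₂) ∨
      (tpRel l₁ = tpRel l₂ ∧ l₁.toFinset ≠ l₂.toFinset ∧ altLex l₁.toFinset l₂.toFinset))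

/-- The matrix `mat(ā)` of a tuple: the `⊏`-increasing enumeration of its set of
entries (one representative from each `≡_{tp(ā)}`-class, in increasing order). -/
def matL {A : Type*} [LinearOrder A] (l : List A) : List A :=
  l.toFinset.sort (· ≤ ·)

/-- The number of `≡_σ`-classes strictly `≺_σ`-below the class of `i`. -/
def classRank (σ : ℕ → ℕ → Prop) (n i : ℕ) : ℕ :=
  (((Finset.range n).filter fun j => σ j i ∧ ¬ σ i j).image (classOf σ n)).card

/-- `tup σ n b` : the `n`-tuple obtained by placing the `ξ`-th entry of `b` on all
coordinates belonging to the `ξ`-th `≡_σ`-class (classes enumerated in the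
`≺_σ`-increasing order). -/
def tup {A : Type*} [Nonempty A] (σ : ℕ → ℕ → Prop) (n : ℕ) (b : List A) : List A :=
  (List.range n).map fun i => b.getD (classRank σ n i) (Classical.arbitrary A)

/-- `m` is the minimum of `S` with respect to a strict order `lt`. -/
def MinWrt {α : Type*} (lt : α → α → Prop) (S : Set α) (m : α) : Prop :=
  m ∈ S ∧ ∀ x ∈ S, x = m ∨ lt m x

/-- `f` maps `S` onto `T` and is rigid w.r.t. the strict orders `ltA`, `ltB`:
minima of preimages of `ltB`-comparable elements are `ltA`-comparable in the
same order. -/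
def IsRigidSurjOn {α β : Type*} (ltA : α → α → Prop) (ltB : β → β → Prop)
    (S : Set α) (T : Set β) (f : α → β) : Prop :=
  (∀ a ∈ S, f a ∈ T) ∧ (∀ b ∈ T, ∃ a ∈ S, f a = b) ∧
    ∀ x ∈ T, ∀ y ∈ T, ltB x y → ∀ a b, MinWrt ltA {u | u ∈ S ∧ f u = x} a →
      MinWrt ltA {u | u ∈ S ∧ f u = y} b → ltA a b

/-- A rigid surjection between chains: a surjection such that
`min f⁻¹(x) ⊏ min f⁻¹(y)` whenever `x ⊏' y`. -/
def IsRigidSurjection {A B : Type*} [LinearOrder A] [LinearOrder B] (f : A → B) : Prop :=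
  Function.Surjective f ∧ ∀ x y : B, x < y → ∀ a b : A,
    IsLeast {u | f u = x} a → IsLeast {v | f v = y} b → a < b

/-! ### The dual Ramsey property for a class of objects with
designated surjective morphisms.

`C ⟶ (B)^A_k` in `C^op` unfolds to: for every `k`-colouring `χ` of the
morphisms `C → A` there are `w : C → B` and a colour `i` such that
`χ(g ∘ w) = i` for every morphism `g : B → A`.  -/

/-- The dual Ramsey property for the (full) subcategory spanned by `S` of the category
whose objects are `Obj` and whose morphisms `X → Y` are the functions
`carrier X → carrier Y` satisfying `IsMor X Y`. -/
def HasDualRamseySub {Obj : Type*} (carrier : Obj → Type*)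
    (IsMor : ∀ X Y : Obj, (carrier X → carrier Y) → Prop) (S : Set Obj) : Prop :=
  ∀ k : ℕ, 2 ≤ k → ∀ A ∈ S, ∀ B ∈ S, (∃ f : carrier B → carrier A, IsMor B A f) →
    ∃ C ∈ S, ∀ χ : (carrier C → carrier A) → Fin k,
      ∃ w : carrier C → carrier B, IsMor C B w ∧ ∃ i : Fin k,
        ∀ g : carrier B → carrier A, IsMor B A g → χ (g ∘ w) = i

/-- The dual Ramsey property for the category whose objects are `Obj` and whose
morphisms `X → Y` are the functions `carrier X → carrier Y` satisfying `IsMor X Y`. -/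
def HasDualRamseyClass {Obj : Type*} (carrier : Obj → Type*)
    (IsMor : ∀ X Y : Obj, (carrier X → carrier Y) → Prop) : Prop :=
  HasDualRamseySub carrier IsMor Set.univ

end

noncomputable section

/-- A finite `r`-erst: a reflexive `r`-ary structure with a linear extension (tuples
represented as lists of length `r`): the relation contains all constant tuples and
every non-constant tuple in it is strictly `⊏`-increasing. -/
structure ERstObj (r : ℕ) where
  carrier : Type
  [fintypeI : Fintype carrier]
  [linearOrderI : LinearOrder carrier]
  rel : Set (List carrier)
  len : ∀ l ∈ rel, l.length = r
  refl : ∀ a : carrier, List.replicate r a ∈ rel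
  ext : ∀ l ∈ rel, (∃ a, l = List.replicate r a) ∨ l.Chain' (· < ·)

attribute [instance] ERstObj.fintypeI ERstObj.linearOrderI

/-- Strong rigid quotient maps: homomorphisms whose coordinatewise extension
`f̂ : (ρ,⊏_sal) → (ρ',⊏'_sal)` is a rigid surjection. The morphisms of
`ERst_srq(r)`. -/
def IsSRQ {r : ℕ} (M N : ERstObj r) (f : M.carrier → N.carrier) : Prop :=
  (∀ l ∈ M.rel, l.map f ∈ N.rel) ∧
    IsRigidSurjOn salLT salLT M.rel N.rel (List.map f)

/-- The relation of the `r`-erst `r ⊗ L` on `{1,…,r} × L`, ordered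
anti-lexicographically (`iℓ ≺ jk` iff `ℓ ⊏ k`, or `ℓ = k` and `i < j`): all constant
tuples together with the tuples `(1ℓ, 2ℓ, …, rℓ)`, `ℓ ∈ L`. -/
def rTensorRel (r : ℕ) (L : Type) [LinearOrder L] : Set (List (Lex (L × Fin r))) :=
  {l | (∃ a, l = List.replicate r a) ∨
    ∃ x : L, l = List.ofFn fun i : Fin r => toLex (x, i)}

/-! ### Restricted growth words -/

/-- `RestrictedGrowth s l m` : every letter of `l` is either among the letters `0, …, s - 1`
or those introduced earlier in `l`, or is the least number not introduced so far; reading the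
whole of `l` introduces exactly the letters `s, …, m - 1`. Words with `s = t` and `m = t + d` are
the `d`-parameter words over the alphabet `{0, …, t - 1}`. -/
def RestrictedGrowth : ℕ → List ℕ → ℕ → Prop
  | s, [], m => s = m
  | s, x :: l, m => (x < s ∧ RestrictedGrowth s l m) ∨ (x = s ∧ RestrictedGrowth (s + 1) l m)

/-- Substitution of the letters of `g` for the parameters `t, t + 1, …`. -/
def substParam (t : ℕ) (g : List ℕ) (x : ℕ) : ℕ :=
  if x < t then x else g.getD (x - t) 0

/-- The part of a word that precedes its first parameter. -/
def constPrefix (t : ℕ) (l : List ℕ) : List ℕ :=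
  l.takeWhile fun x => x < t

namespace RestrictedGrowth

theorem append_iff {s m : ℕ} {l₁ l₂ : List ℕ} :
    RestrictedGrowth s (l₁ ++ l₂) m ↔
      ∃ s', RestrictedGrowth s l₁ s' ∧ RestrictedGrowth s' l₂ m := by
  induction l₁ generalizing s with
  | nil => simp [RestrictedGrowth]
  | cons x l ih =>
    simp only [List.cons_append, RestrictedGrowth, ih]
    grind

theorem of_forall_lt {s : ℕ} {l : List ℕ} (h : ∀ x ∈ l, x < s) : RestrictedGrowth s l s := by
  induction l with
  | nil => simp [RestrictedGrowth]
  | cons x l ih => exact Or.inl ⟨h x (by simp), ih fun y hy => h y (by simp [hy])⟩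

theorem le {s m : ℕ} {l : List ℕ} (h : RestrictedGrowth s l m) : s ≤ m := by
  induction l generalizing s with
  | nil => exact Nat.le_of_eq h
  | cons x l ih =>
    rcases h with h | h
    · exact ih h.2
    · have := ih h.2
      omega

theorem lt_of_mem {s m : ℕ} {l : List ℕ} (h : RestrictedGrowth s l m) : ∀ x ∈ l, x < m := by
  induction l generalizing s with
  | nil => simp
  | cons x l ih =>
    rcases h with h | h <;> have h₁ := h.2.le <;> have h₂ := ih h.2 <;>
      simp only [List.mem_cons, forall_eq_or_imp] <;> exact ⟨by omega, h₂⟩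

theorem mem {s m j : ℕ} {l : List ℕ} (h : RestrictedGrowth s l m) (hs : s ≤ j) (hj : j < m) :
    j ∈ l := by
  induction l generalizing s with
  | nil => simp only [RestrictedGrowth] at h; omega
  | cons x l ih =>
    rcases h with h | h
    · exact List.mem_cons_of_mem _ (ih h.2 hs)
    · rcases hs.eq_or_lt with rfl | hs
      · simp [h.1]
      · exact List.mem_cons_of_mem _ (ih h.2 hs)

theorem range' (s n : ℕ) : RestrictedGrowth s (List.range' s n) (s + n) := by
  induction n generalizing s with
  | zero => simp [RestrictedGrowth]
  | succ n ih =>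
    rw [List.range'_succ]
    refine Or.inr ⟨rfl, ?_⟩
    have := ih (s + 1)
    rwa [show s + 1 + n = s + (n + 1) by omega] at this

theorem map {s M t m : ℕ} {w : List ℕ} {h : ℕ → ℕ} (hw : RestrictedGrowth s w M)
    (hs : ∀ i < s, h i < t) (hm : RestrictedGrowth t ((List.range' s (M - s)).map h) m) :
    RestrictedGrowth t (w.map h) m := by
  induction w generalizing s t with
  | nil =>
    simp only [RestrictedGrowth] at hw
    subst hw
    simpa using hm
  | cons x l ih =>
    rcases hw with ⟨hx, hw⟩ | ⟨rfl, hw⟩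
    · exact Or.inl ⟨hs x hx, ih hw hs hm⟩
    · have hle := hw.le
      rw [show M - x = (M - (x + 1)) + 1 by omega, List.range'_succ] at hm
      rcases hm with ⟨hx, hm⟩ | ⟨hx, hm⟩
      · refine Or.inl ⟨hx, ih hw (fun i hi => ?_) hm⟩
        rcases Nat.lt_succ_iff_lt_or_eq.1 hi with hi | rfl
        exacts [hs i hi, hx]
      · refine Or.inr ⟨hx, ih hw (fun i hi => ?_) hm⟩
        rcases Nat.lt_succ_iff_lt_or_eq.1 hi with hi | rfl
        exacts [(hs i hi).trans (Nat.lt_succ_self t), hx ▸ Nat.lt_succ_self _]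

theorem exists_split {t m : ℕ} {g : List ℕ} (h : RestrictedGrowth t g m) (htm : t < m) :
    ∃ p r, g = p ++ t :: r ∧ (∀ x ∈ p, x < t) ∧ RestrictedGrowth (t + 1) r m := by
  induction g with
  | nil => simp only [RestrictedGrowth] at h; omega
  | cons x l ih =>
    rcases h with ⟨hx, h⟩ | ⟨rfl, h⟩
    · obtain ⟨p, r, rfl, hp, hr⟩ := ih h
      exact ⟨x :: p, r, rfl, by simpa using ⟨hx, hp⟩, hr⟩
    · exact ⟨[], l, rfl, by simp, h⟩

/-- A word is of restricted growth if its letters exceeding the initial alphabet appear for the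
first time in increasing order. -/
theorem of_forall_exists_lt {s m : ℕ} {l : List ℕ} (hsm : s ≤ m) (hlt : ∀ x ∈ l, x < m)
    (hmem : ∀ y, s ≤ y → y < m → y ∈ l)
    (h : ∀ (i : ℕ) (hi : i < l.length) (y : ℕ), s ≤ y → y < l[i] →
      ∃ (j : ℕ) (hj : j < i), l[j]'(hj.trans hi) = y) :
    RestrictedGrowth s l m := by
  induction l generalizing s with
  | nil =>
    by_contra hne
    simpa using hmem s le_rfl (lt_of_le_of_ne hsm hne)
  | cons x l ih =>
    have hx : x ≤ s := by
      by_contra! hx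
      obtain ⟨j, hj, -⟩ := h 0 (by simp) s le_rfl (by simpa using hx)
      omega
    have key : ∀ s', s ≤ s' → x < s' → ∀ (i : ℕ) (hi : i < l.length) (y : ℕ), s' ≤ y → y < l[i] →
        ∃ (j : ℕ) (hj : j < i), l[j]'(hj.trans hi) = y := by
      intro s' hs' hxs i hi y hy hyi
      obtain ⟨j, hj, hjy⟩ := h (i + 1) (by simpa using hi) y (hs'.trans hy) (by simpa using hyi)
      rcases j with _ | j
      · simp only [List.getElem_cons_zero] at hjy
        omega
      · exact ⟨j, by omega, by simpa using hjy⟩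
    have hmem' : ∀ s', s ≤ s' → x < s' → ∀ y, s' ≤ y → y < m → y ∈ l := by
      intro s' hs' hxs y hy hym
      have := hmem y (hs'.trans hy) hym
      rw [List.mem_cons] at this
      exact this.resolve_left (by omega)
    have hlt' : ∀ y ∈ l, y < m := fun y hy => hlt y (by simp [hy])
    rcases hx.lt_or_eq with hx | rfl
    · exact Or.inl ⟨hx, ih hsm hlt' (hmem' s le_rfl hx) (key s le_rfl hx)⟩
    · exact Or.inr ⟨rfl, ih (hlt x (by simp)) hlt' (hmem' _ (by omega) (by omega))
        (key _ (by omega) (by omega))⟩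

/-- In a word of restricted growth smaller letters appear before bigger ones. -/
theorem exists_lt_getElem_eq {s m : ℕ} {l : List ℕ} (h : RestrictedGrowth s l m) {i : ℕ}
    (hi : i < l.length) {y : ℕ} (hy : s ≤ y) (hyi : y < l[i]) :
    ∃ (j : ℕ) (hj : j < i), l[j]'(hj.trans hi) = y := by
  have h' : RestrictedGrowth s (l.take i ++ l.drop i) m := by rwa [List.take_append_drop]
  obtain ⟨s', h₁, h₂⟩ := append_iff.1 h'
  rw [List.drop_eq_getElem_cons hi] at h₂
  have hys : y < s' := by rcases h₂ with h₂ | h₂ <;> omega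
  obtain ⟨j, hj, hjy⟩ := List.mem_iff_getElem.1 (h₁.mem hy hys)
  rw [List.length_take] at hj
  exact ⟨j, by omega, by simpa using hjy⟩

end RestrictedGrowth

section substParam

variable {t : ℕ}

theorem substParam_of_lt {x : ℕ} (g : List ℕ) (h : x < t) : substParam t g x = x := by
  simp [substParam, h]

theorem substParam_add (g : List ℕ) (i : ℕ) : substParam t g (t + i) = g.getD i 0 := by
  simp [substParam]

theorem map_range'_substParam (g : List ℕ) :
    (List.range' t g.length).map (substParam t g) = g := by
  apply List.ext_getElem
  · simp
  · intro i h₁ h₂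
    simp [substParam_add, List.getElem?_eq_getElem h₂]

theorem map_range'_substParam_append (u g : List ℕ) :
    (List.range' (t + u.length) g.length).map (substParam t (u ++ g)) = g := by
  have := map_range'_substParam (t := t) (u ++ g)
  rw [List.length_append, ← List.range'_append_1, List.map_append] at this
  exact (List.append_inj this (by simp)).2

theorem RestrictedGrowth.map_substParam {w g : List ℕ} {m : ℕ}
    (hw : RestrictedGrowth t w (t + g.length)) (hg : RestrictedGrowth t g m) :
    RestrictedGrowth t (w.map (substParam t g)) m := by
  refine hw.map (fun i hi => by rwa [substParam_of_lt g hi]) ?_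
  rwa [Nat.add_sub_cancel_left, map_range'_substParam]

theorem map_substParam_map_substParam (ht : 0 < t) (w g h : List ℕ) :
    (w.map (substParam t g)).map (substParam t h) =
      w.map (substParam t (g.map (substParam t h))) := by
  rw [List.map_map]
  refine List.map_congr_left fun x _ => ?_
  rcases lt_or_ge x t with hx | hx
  · simp [substParam_of_lt _ hx]
  · obtain ⟨i, rfl⟩ := Nat.exists_eq_add_of_le hx
    simp only [Function.comp_apply, substParam_add]
    conv_rhs => rw [← substParam_of_lt h ht]
    exact (List.getD_map g 0 (substParam t h)).symm

theorem substParam_append_of_lt {g : List ℕ} (h : List ℕ) {x : ℕ} (hx : x < t + g.length) :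
    substParam t (g ++ h) x = substParam t g x := by
  rcases lt_or_ge x t with hx' | hx'
  · simp [substParam_of_lt _ hx']
  · obtain ⟨i, rfl⟩ := Nat.exists_eq_add_of_le hx'
    rw [substParam_add, substParam_add, List.getD_append _ _ _ _ (by omega)]

theorem map_substParam_append {w g : List ℕ} (h : List ℕ) (hw : ∀ x ∈ w, x < t + g.length) :
    w.map (substParam t (g ++ h)) = w.map (substParam t g) :=
  List.map_congr_left fun x hx => substParam_append_of_lt h (hw x hx)

theorem substParam_lt {g : List ℕ} (hg : ∀ x ∈ g, x < t) {x : ℕ} (hx : x < t + g.length) :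
    substParam t g x < t := by
  rcases lt_or_ge x t with hx' | hx'
  · rwa [substParam_of_lt _ hx']
  · obtain ⟨i, rfl⟩ := Nat.exists_eq_add_of_le hx'
    rw [substParam_add, List.getD_eq_getElem _ _ (by omega)]
    exact hg _ (List.getElem_mem _)

end substParam

section constPrefix

variable {t : ℕ}

theorem constPrefix_append_cons {p : List ℕ} (hp : ∀ x ∈ p, x < t) {y : ℕ} (hy : t ≤ y)
    (r : List ℕ) : constPrefix t (p ++ y :: r) = p := by
  induction p with
  | nil => simp [constPrefix, hy]
  | cons x p ih =>
    have hx : x < t := hp x (by simp)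
    have := ih fun z hz => hp z (by simp [hz])
    simp only [constPrefix] at this
    simp [constPrefix, hx, this]

theorem exists_eq_constPrefix_append {l : List ℕ} (h : ∃ x ∈ l, t ≤ x) :
    ∃ y r, l = constPrefix t l ++ y :: r ∧ t ≤ y := by
  induction l with
  | nil => simp at h
  | cons x l ih =>
    rcases lt_or_ge x t with hx | hx
    · obtain ⟨z, hz, htz⟩ := h
      rcases List.mem_cons.1 hz with rfl | hz
      · omega
      · obtain ⟨y, r, hl, hy⟩ := ih ⟨z, hz, htz⟩
        refine ⟨y, r, ?_, hy⟩
        simp only [constPrefix] at hl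
        simp only [constPrefix, List.takeWhile_cons, hx, decide_true, if_true, List.cons_append]
        rw [← hl]
    · exact ⟨x, l, by simp [constPrefix, hx], hx⟩

theorem forall_constPrefix_lt (l : List ℕ) : ∀ x ∈ constPrefix t l, x < t := by
  intro x hx
  simpa using List.mem_takeWhile_imp hx

theorem constPrefix_append {l : List ℕ} (h : ∃ x ∈ l, t ≤ x) (l' : List ℕ) :
    constPrefix t (l ++ l') = constPrefix t l := by
  obtain ⟨y, r, hl, hy⟩ := exists_eq_constPrefix_append h
  conv_lhs => rw [hl]
  rw [List.append_assoc, List.cons_append,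
    constPrefix_append_cons (forall_constPrefix_lt l) hy]

/-- The constant prefix of a composite only depends on the constant prefix of the word that is
being substituted. -/
theorem constPrefix_map_substParam_congr {s M y y' : ℕ} {V p : List ℕ} (r r' : List ℕ)
    (hV : RestrictedGrowth s V M) (hs : s ≤ t + p.length) (hp : ∀ x ∈ p, x < t)
    (hy : t ≤ y) (hy' : t ≤ y') :
    constPrefix t (V.map (substParam t (p ++ y :: r))) =
      constPrefix t (V.map (substParam t (p ++ y' :: r'))) := by
  induction V generalizing s with
  | nil => rfl
  | cons x V ih =>
    simp only [constPrefix] at ih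
    simp only [constPrefix, List.map_cons, List.takeWhile_cons]
    rcases lt_or_ge x (t + p.length) with hx | hx
    · have hlt := substParam_lt hp hx
      rw [substParam_append_of_lt _ hx, substParam_append_of_lt _ hx]
      simp only [hlt, decide_true, if_true]
      congr 1
      rcases hV with ⟨hx', hV⟩ | ⟨rfl, hV⟩
      · exact ih hV hs
      · exact ih hV hx
    · have hx' : x = t + p.length := by rcases hV with hV | hV <;> omega
      subst hx'
      simp [substParam_add, not_lt.2 hy, not_lt.2 hy']

/-- Appending one new parameter to `z`: a substitution whose first parameter is at the very end. -/
theorem constPrefix_map_append_singleton {z p : List ℕ} {y : ℕ}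
    (hz : RestrictedGrowth t z (t + p.length)) (hp : ∀ x ∈ p, x < t) (hy : t ≤ y) :
    constPrefix t ((z ++ [t + p.length]).map (substParam t (p ++ [y]))) =
      z.map (substParam t p) := by
  rw [List.map_append, map_substParam_append _ hz.lt_of_mem, List.map_singleton, substParam_add]
  simp only [List.getD_append_right _ _ _ _ le_rfl, Nat.sub_self, List.getD_cons_zero]
  refine constPrefix_append_cons (fun x hx => ?_) hy []
  obtain ⟨a, ha, rfl⟩ := List.mem_map.1 hx
  exact substParam_lt hp (hz.lt_of_mem a ha)

theorem exists_mem_map_substParam {z p r : List ℕ} {y M : ℕ}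
    (hz : RestrictedGrowth t z M) (hM : t + p.length < M) (hy : t ≤ y) :
    ∃ x ∈ z.map (substParam t (p ++ y :: r)), t ≤ x := by
  refine ⟨y, List.mem_map.2 ⟨t + p.length, hz.mem (by omega) hM, ?_⟩, hy⟩
  simp [substParam_add]

/-- Appending one new parameter to `z`: a substitution whose first parameter is not at the end. -/
theorem constPrefix_map_append_singleton' {z p r : List ℕ} {y x a : ℕ}
    (hz : RestrictedGrowth t z (t + (p ++ y :: r).length)) (hy : t ≤ y) :
    constPrefix t ((z ++ [a]).map (substParam t (p ++ y :: (r ++ [x])))) =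
      constPrefix t (z.map (substParam t (p ++ y :: r))) := by
  rw [← List.cons_append, ← List.append_assoc, List.map_append,
    map_substParam_append _ hz.lt_of_mem]
  exact constPrefix_append (exists_mem_map_substParam hz (by simp) hy) _

end constPrefix

/-! ### The Graham–Rothschild theorem -/

/-- The Graham–Rothschild property for words over `{0, …, t - 1}` with `m - t` parameters. -/
def GrahamRothschild (t m : ℕ) : Prop :=
  ∀ (D : ℕ) (κ : Type) [Finite κ], ∃ n : ℕ, ∀ χ : List ℕ → κ, ∃ w : List ℕ,
    w.length = n ∧ RestrictedGrowth t w (t + D) ∧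
      ∀ g g' : List ℕ, g.length = D → g'.length = D →
        RestrictedGrowth t g m → RestrictedGrowth t g' m →
          χ (w.map (substParam t g)) = χ (w.map (substParam t g'))

theorem exists_eq_ofFn {t D : ℕ} {u : List ℕ} (hD : u.length = D) (hu : ∀ x ∈ u, x < t) :
    ∃ f : Fin D → Fin t, u = List.ofFn fun i => (f i : ℕ) := by
  subst hD
  exact ⟨fun i => ⟨u[i], hu _ (List.getElem_mem _)⟩, by simp⟩

/-- The block of letters `t, …, t + D - 1` for the variable coordinates of a line, and the
constant block for the other ones. -/
def lineBlock (t D : ℕ) : Option (Fin D → Fin t) → List ℕ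
  | none => List.range' t D
  | some a => List.ofFn fun i => (a i : ℕ)

theorem lineBlock_map {t D : ℕ} (f : Fin D → Fin t) (o : Option (Fin D → Fin t)) :
    (lineBlock t D o).map (substParam t (List.ofFn fun i => (f i : ℕ))) =
      List.ofFn fun i => ((o.getD f) i : ℕ) := by
  cases o with
  | none =>
    have := map_range'_substParam (t := t) (List.ofFn fun i => (f i : ℕ))
    rw [List.length_ofFn] at this
    exact this
  | some a =>
    simp only [lineBlock, Option.getD_some]
    conv_rhs => rw [← List.map_id (List.ofFn fun i => (a i : ℕ))]
    refine List.map_congr_left fun x hx => ?_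
    obtain ⟨i, rfl⟩ := List.mem_ofFn.1 hx
    exact substParam_of_lt _ (a i).2

theorem lineBlock_length {t D : ℕ} (o : Option (Fin D → Fin t)) :
    (lineBlock t D o).length = D := by
  cases o <;> simp [lineBlock]

theorem lineBlock_lt {t D : ℕ} (o : Option (Fin D → Fin t)) :
    ∀ x ∈ lineBlock t D o, x < t + D := by
  intro x hx
  cases o with
  | none => simp only [lineBlock, List.mem_range'_1] at hx; omega
  | some a =>
    obtain ⟨i, rfl⟩ := List.mem_ofFn.1 hx
    exact (a i).2.trans_le (Nat.le_add_right _ _)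

theorem restrictedGrowth_flatMap_lineBlock {t D : ℕ} (os : List (Option (Fin D → Fin t)))
    (h : none ∈ os) : RestrictedGrowth t (os.flatMap (lineBlock t D)) (t + D) := by
  induction os with
  | nil => simp at h
  | cons o os ih =>
    rw [List.flatMap_cons, RestrictedGrowth.append_iff]
    cases o with
    | none =>
      refine ⟨t + D, RestrictedGrowth.range' t D, RestrictedGrowth.of_forall_lt fun x hx => ?_⟩
      obtain ⟨o, -, hx⟩ := List.mem_flatMap.1 hx
      exact lineBlock_lt o x hx
    | some a =>
      refine ⟨t, RestrictedGrowth.of_forall_lt fun x hx => ?_, ih (by simpa using h)⟩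
      obtain ⟨i, rfl⟩ := List.mem_ofFn.1 hx
      exact (a i).2

/-- The multidimensional Hales–Jewett theorem is the Graham–Rothschild theorem for words without
parameters. -/
theorem grahamRothschild_self (t : ℕ) : GrahamRothschild t t := by
  intro D κ _
  obtain ⟨ι, _, hι⟩ := Combinatorics.Line.exists_mono_in_high_dimension (Fin D → Fin t) κ
  set L : List ι := (Finset.univ : Finset ι).toList with hL
  refine ⟨L.length * D, fun χ => ?_⟩
  obtain ⟨l, c, hc⟩ := hι fun f => χ (L.flatMap fun i => List.ofFn fun j => (f i j : ℕ))
  obtain ⟨i₀, hi₀⟩ := l.proper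
  have key : ∀ g : List ℕ, g.length = D → RestrictedGrowth t g t →
      χ (((L.map l.idxFun).flatMap (lineBlock t D)).map (substParam t g)) = c := by
    intro g hD hg
    obtain ⟨f, rfl⟩ := exists_eq_ofFn hD hg.lt_of_mem
    rw [← hc f, List.map_flatMap, List.flatMap_map]
    congr 2
    funext i
    exact lineBlock_map f (l.idxFun i)
  refine ⟨(L.map l.idxFun).flatMap (lineBlock t D), ?_, ?_, fun g g' hg hg' h h' => ?_⟩
  · simp [List.length_flatMap, lineBlock_length, Function.comp_def]
  · exact restrictedGrowth_flatMap_lineBlock _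
      (List.mem_map.2 ⟨i₀, by simp [hL], hi₀⟩)
  · rw [key g hg h, key g' hg' h']

/-- There are subspaces in which the colour of a word with parameters depends only on the part of
the word preceding the first parameter. The statement allows an additional prefix `u` of `q`
constants that may be used as letters. -/
theorem GrahamRothschild.exists_insensitive {t m : ℕ} (ht : 0 < t) (h : GrahamRothschild (t + 1) m)
    (κ : Type) [Finite κ] (D q : ℕ) :
    ∃ n : ℕ, ∀ χ : List ℕ → κ, ∃ w : List ℕ, w.length = n ∧
      RestrictedGrowth (t + q) w (t + q + D) ∧
      ∀ u p v v' : List ℕ, u.length = q → (∀ x ∈ u, x < t) → (∀ x ∈ p, x < t) →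
        p.length + 1 + v.length = D → p.length + 1 + v'.length = D →
        RestrictedGrowth (t + 1) v m → RestrictedGrowth (t + 1) v' m →
        χ (u ++ w.map (substParam t (u ++ (p ++ t :: v)))) =
          χ (u ++ w.map (substParam t (u ++ (p ++ t :: v')))) := by
  induction D generalizing q with
  | zero =>
    refine ⟨0, fun χ => ⟨[], rfl, rfl, ?_⟩⟩
    intros
    omega
  | succ D ih =>
    obtain ⟨n₂, h₂⟩ := ih (q + 1)
    obtain ⟨n₁, h₁⟩ := h n₂ ((Fin q → Fin t) → κ)
    refine ⟨n₁ + 1, fun χ => ?_⟩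
    obtain ⟨w₁, hl₁, hw₁, hc₁⟩ :=
      h₁ fun x f => χ ((List.ofFn fun i => (f i : ℕ)) ++ t :: x)
    obtain ⟨w₂, hl₂, hw₂, hc₂⟩ :=
      h₂ fun y => χ (y.take (q + 1) ++ w₁.map (substParam t (y.drop q)))
    refine ⟨(t + q) :: w₁.map (substParam t ((t + q) :: w₂)), by simp [hl₁], ?_, ?_⟩
    · refine Or.inr ⟨rfl, hw₁.map (t := t + q + 1) (fun i hi => ?_) ?_⟩
      · rcases Nat.lt_succ_iff_lt_or_eq.1 hi with hi | rfl
        · rw [substParam_of_lt _ hi]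
          omega
        · simp [substParam]
      · have := map_range'_substParam (t := t) ((t + q) :: w₂)
        rw [List.length_cons, List.range'_succ, List.map_cons, List.cons.injEq] at this
        rw [Nat.add_sub_cancel_left, ← hl₂, this.2]
        rwa [show t + (q + 1) + D = t + q + (D + 1) by omega] at hw₂
    · rintro u p v v' rfl hu hp hv hv' hgv hgv'
      have hhead : ∀ (a : ℕ) (y : List ℕ), (u ++ a :: y).getD u.length 0 = a := by simp
      have heq : ∀ z x, substParam t (t :: z) x = substParam (t + 1) z x := by
        intro z x
        rcases lt_trichotomy x t with hx | rfl | hx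
        · rw [substParam_of_lt _ hx, substParam_of_lt _ (hx.trans (Nat.lt_succ_self t))]
        · simp [substParam]
        · obtain ⟨i, rfl⟩ := Nat.exists_eq_add_of_lt hx
          simp [substParam, show t + i + 1 - t = i + 1 by omega,
            show t + i + 1 - (t + 1) = i by omega, show ¬ (t + i + 1 < t) by omega]
      rcases p with _ | ⟨a, p⟩
      · obtain ⟨f, hf⟩ := exists_eq_ofFn rfl hu
        have hz : ∀ v : List ℕ, 0 + 1 + v.length = D + 1 → RestrictedGrowth (t + 1) v m →
            RestrictedGrowth (t + 1) (w₂.map (substParam t (u ++ t :: v))) m := by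
          intro v hv hgv
          refine hw₂.map (fun i hi => ?_) ?_
          · rcases lt_or_ge i t with hit | hit
            · rw [substParam_of_lt _ hit]
              omega
            · obtain ⟨j, rfl⟩ := Nat.exists_eq_add_of_le hit
              rw [substParam_add]
              rcases (show j < u.length ∨ j = u.length by omega) with hj | rfl
              · rw [List.getD_append _ _ _ _ hj, List.getD_eq_getElem _ _ hj]
                exact (hu _ (List.getElem_mem _)).trans (Nat.lt_succ_self t)
              · simp
          · have := map_range'_substParam_append (t := t) (u ++ [t]) v
            rw [List.length_append, List.length_singleton, List.append_assoc,
              List.singleton_append] at this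
            rw [Nat.add_sub_cancel_left, show D = v.length by omega, this]
            exact hgv
        have := congrFun (hc₁ (w₂.map (substParam t (u ++ t :: v)))
          (w₂.map (substParam t (u ++ t :: v'))) (by simpa using hl₂) (by simpa using hl₂)
          (hz v hv hgv) (hz v' hv' hgv')) f
        simp only [List.nil_append, List.map_cons, map_substParam_map_substParam ht, substParam_add]
        simp only [← hf] at this
        simpa [funext (heq _)] using this
      · have := hc₂ (u ++ [a]) p v v' (by simp) (by simpa [or_imp, forall_and] using
          ⟨hu, hp a (by simp)⟩) (fun x hx => hp x (by simp [hx]))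
          (by rw [List.length_cons] at hv; omega) (by rw [List.length_cons] at hv'; omega) hgv hgv'
        have htake : ∀ y, (u ++ [a] ++ y).take (u.length + 1) = u ++ [a] := fun y =>
          List.take_left' (by simp)
        have hdrop : ∀ y, (u ++ [a] ++ y).drop u.length = a :: y := fun y => by
          rw [List.append_assoc, List.drop_left, List.singleton_append]
        simp only [htake, hdrop] at this
        simp only [List.append_assoc, List.singleton_append] at this
        simpa only [List.map_cons, map_substParam_map_substParam ht, substParam_add, hhead,
          List.cons_append] using this

/-- There are subspaces in which the colour of the part of a word preceding the first parameter
depends only on its length. -/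
theorem exists_constPrefix_eq {t : ℕ} (ht : 0 < t) (κ : Type) [Finite κ] (D : ℕ) :
    ∃ n : ℕ, ∀ c : List ℕ → κ, ∃ w : List ℕ, w.length = n ∧ RestrictedGrowth t w (t + D) ∧
      ∀ (p p' r r' : List ℕ) (y y' : ℕ), (∀ x ∈ p, x < t) → (∀ x ∈ p', x < t) →
        p.length = p'.length → t ≤ y → t ≤ y' →
        p.length + 1 + r.length = D → p'.length + 1 + r'.length = D →
        c (constPrefix t (w.map (substParam t (p ++ y :: r)))) =
          c (constPrefix t (w.map (substParam t (p' ++ y' :: r')))) := by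
  induction D with
  | zero =>
    refine ⟨0, fun χ => ⟨[], rfl, rfl, ?_⟩⟩
    intros
    omega
  | succ D ih =>
    obtain ⟨n₁, h₁⟩ := ih
    obtain ⟨n, h⟩ := grahamRothschild_self t n₁ κ
    refine ⟨n + 1, fun c => ?_⟩
    obtain ⟨V, hVl, hV, hVc⟩ := h c
    obtain ⟨v, hvl, hv, hvc⟩ := h₁ fun p => c (constPrefix t (V.map (substParam t (p ++ [t]))))
    have hz : RestrictedGrowth t (V.map (substParam t v)) (t + D) :=
      RestrictedGrowth.map_substParam (by rwa [hvl]) hv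
    refine ⟨V.map (substParam t v) ++ [t + D], by simp [hVl],
      RestrictedGrowth.append_iff.2 ⟨_, hz, Or.inr ⟨rfl, rfl⟩⟩, ?_⟩
    intro p p' r r' y y' hp hp' hpp hy hy' hl hl'
    rcases List.eq_nil_or_concat r with rfl | ⟨r, x, rfl⟩
    · obtain rfl : r' = [] := List.eq_nil_of_length_eq_zero (by simp at hl; omega)
      obtain rfl : D = p.length := by simpa using hl.symm
      rw [constPrefix_map_append_singleton hz hp hy]
      rw [hpp] at hz hv ⊢
      rw [constPrefix_map_append_singleton hz hp' hy', map_substParam_map_substParam ht,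
        map_substParam_map_substParam ht]
      exact hVc _ _ (by simp [hvl]) (by simp [hvl])
        (RestrictedGrowth.map_substParam (by rwa [hpp]) (.of_forall_lt hp))
        (RestrictedGrowth.map_substParam hv (.of_forall_lt hp'))
    · rcases List.eq_nil_or_concat r' with rfl | ⟨r', x', rfl⟩
      · simp at hl hl'
        omega
      have key : ∀ (p r : List ℕ) (y x : ℕ), t ≤ y → p.length + 1 + r.length = D →
          constPrefix t ((V.map (substParam t v) ++ [t + D]).map
            (substParam t (p ++ y :: (r ++ [x])))) =
          constPrefix t (V.map (substParam t
            (constPrefix t (v.map (substParam t (p ++ y :: r))) ++ [t]))) := by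
        intro p r y x hy hl
        have hlen : t + D = t + (p ++ y :: r).length := by simp; omega
        rw [constPrefix_map_append_singleton' (hlen ▸ hz) hy, map_substParam_map_substParam ht]
        obtain ⟨y₂, r₂, hf, hy₂⟩ := exists_eq_constPrefix_append
          (exists_mem_map_substParam (p := p) (r := r) hv (by omega) hy)
        conv_lhs => rw [hf]
        exact constPrefix_map_substParam_congr _ _ hV (by omega) (forall_constPrefix_lt _) hy₂
          le_rfl
      simp only [List.concat_eq_append, List.length_append, List.length_singleton] at hl hl'
      rw [List.concat_eq_append, List.concat_eq_append, key _ _ _ _ hy (by omega),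
        key _ _ _ _ hy' (by omega)]
      exact hvc p p' r r' y y' hp hp' hpp hy hy' (by omega) (by omega)

/-- If at least `D` numbers below `n` satisfy `P`, then there is a word of length `n` with `D`
parameters all of which appear for the first time at positions satisfying `P`. -/
theorem exists_forall_constPrefix_length {t : ℕ} (ht : 0 < t) (P : ℕ → Prop) (n D : ℕ)
    (hD : D ≤ Nat.count P n) :
    ∃ w : List ℕ, w.length = n ∧ RestrictedGrowth t w (t + D) ∧
      ∀ (p r : List ℕ) (y : ℕ), (∀ x ∈ p, x < t) → t ≤ y → p.length + 1 + r.length = D →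
        P (constPrefix t (w.map (substParam t (p ++ y :: r)))).length := by
  induction n generalizing D with
  | zero =>
    obtain rfl : D = 0 := by simpa using hD
    refine ⟨[], rfl, rfl, ?_⟩
    intros
    omega
  | succ n ih =>
    rw [Nat.count_succ] at hD
    rcases Nat.lt_or_ge (Nat.count P n) D with hlt | hle
    · have hP : P n := by
        by_contra hP
        rw [if_neg hP] at hD
        omega
      rw [if_pos hP] at hD
      obtain ⟨D, rfl⟩ : ∃ D', D = D' + 1 := ⟨D - 1, by omega⟩
      obtain ⟨z, hzl, hz, hzP⟩ := ih D (by omega)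
      refine ⟨z ++ [t + D], by simp [hzl],
        RestrictedGrowth.append_iff.2 ⟨_, hz, Or.inr ⟨rfl, rfl⟩⟩, fun p r y hp hy hl => ?_⟩
      rcases List.eq_nil_or_concat r with rfl | ⟨r, x, rfl⟩
      · obtain rfl : D = p.length := by simpa using hl.symm
        rw [constPrefix_map_append_singleton hz hp hy, List.length_map, hzl]
        exact hP
      · simp only [List.concat_eq_append, List.length_append, List.length_singleton] at hl
        have hlen : t + D = t + (p ++ y :: r).length := by simp; omega
        rw [List.concat_eq_append, constPrefix_map_append_singleton' (hlen ▸ hz) hy]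
        exact hzP p r y hp hy (by omega)
    · obtain ⟨z, hzl, hz, hzP⟩ := ih D hle
      refine ⟨z ++ [0], by simp [hzl],
        RestrictedGrowth.append_iff.2 ⟨_, hz, .of_forall_lt (by simp [ht])⟩,
        fun p r y hp hy hl => ?_⟩
      rw [List.map_append, constPrefix_append (exists_mem_map_substParam hz (by omega) hy)]
      exact hzP p r y hp hy hl

theorem exists_le_count_eq (κ : Type) [Fintype κ] [Nonempty κ] (D : ℕ) (c : ℕ → κ) :
    ∃ a, D ≤ Nat.count (fun j => c j = a) (Fintype.card κ * D) := by
  obtain ⟨a, -, ha⟩ := Finset.exists_le_card_fiber_of_mul_le_card_of_maps_to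
    (s := Finset.range (Fintype.card κ * D)) (t := Finset.univ) (f := c) (n := D)
    (by simp) Finset.univ_nonempty (by simp)
  exact ⟨a, by rwa [Nat.count_eq_card_filter_range]⟩

theorem GrahamRothschild.of_succ {t m : ℕ} (ht : 0 < t) (htm : t < m)
    (h : GrahamRothschild (t + 1) m) : GrahamRothschild t m := by
  intro D κ _
  have := Fintype.ofFinite (Option κ)
  obtain ⟨n₂, h₂⟩ := exists_constPrefix_eq ht (Option κ) (Fintype.card (Option κ) * D)
  obtain ⟨n₁, h₁⟩ := h.exists_insensitive ht κ n₂ 0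
  refine ⟨n₁, fun χ => ?_⟩
  obtain ⟨w₁, hl₁, hw₁, hc₁⟩ := h₁ χ
  let Ext (p v : List ℕ) : Prop := p.length + 1 + v.length = n₂ ∧ RestrictedGrowth (t + 1) v m
  obtain ⟨c, hc⟩ : ∃ c : List ℕ → Option κ, c = fun p => if h : ∃ v, Ext p v then
    some (χ (w₁.map (substParam t (p ++ t :: h.choose)))) else none := ⟨_, rfl⟩
  obtain ⟨w₂, hl₂, hw₂, hc₂⟩ := h₂ c
  set D₃ := Fintype.card (Option κ) * D with hD₃
  obtain ⟨a, ha⟩ := exists_le_count_eq (Option κ) D fun j => c (constPrefix t (w₂.map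
    (substParam t (List.replicate j 0 ++ t :: List.replicate (D₃ - 1 - j) 0))))
  obtain ⟨z, hlz, hz, hcz⟩ := exists_forall_constPrefix_length ht _ _ _ ha
  have key : ∀ g : List ℕ, g.length = D → RestrictedGrowth t g m →
      some (χ ((w₁.map (substParam t (w₂.map (substParam t z)))).map (substParam t g))) = a := by
    intro g hgD hg
    have hg₃ : RestrictedGrowth t (z.map (substParam t g)) m :=
      RestrictedGrowth.map_substParam (by rwa [hgD]) hg
    have hg₂ : RestrictedGrowth t (w₂.map (substParam t (z.map (substParam t g)))) m :=
      RestrictedGrowth.map_substParam (by rwa [List.length_map, hlz]) hg₃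
    have hlg₃ : (z.map (substParam t g)).length = D₃ := by rw [List.length_map, hlz]
    have hlg₂ : (w₂.map (substParam t (z.map (substParam t g)))).length = n₂ := by
      rw [List.length_map, hl₂]
    rw [map_substParam_map_substParam ht, map_substParam_map_substParam ht]
    obtain ⟨p, r, rfl, hp, hr⟩ := hg.exists_split htm
    have hcz' := hcz p r t hp le_rfl (by simpa [Nat.add_assoc, Nat.add_comm 1] using hgD)
    generalize z.map (substParam t (p ++ t :: r)) = g₃ at *
    obtain ⟨p₃, r₃, rfl, hp₃, hr₃⟩ := hg₃.exists_split htm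
    rw [constPrefix_append_cons hp₃ le_rfl] at hcz'
    simp only [List.length_append, List.length_cons] at hlg₃
    rw [hc₂ (List.replicate p₃.length 0) p₃ _ r₃ t t (by simp [ht]) hp₃ (by simp) le_rfl le_rfl
      (by simp only [List.length_replicate]; omega) (by omega)] at hcz'
    generalize w₂.map (substParam t (p₃ ++ t :: r₃)) = g₂ at *
    obtain ⟨p₂, r₂, rfl, hp₂, hr₂⟩ := hg₂.exists_split htm
    rw [constPrefix_append_cons hp₂ le_rfl] at hcz'
    simp only [List.length_append, List.length_cons] at hlg₂
    have hex : ∃ v, Ext p₂ v := ⟨r₂, by omega, hr₂⟩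
    rw [← hcz', hc]
    simp only [dif_pos hex]
    congr 1
    exact hc₁ [] p₂ _ _ rfl (by simp) hp₂ (by omega) hex.choose_spec.1 hr₂ hex.choose_spec.2
  refine ⟨w₁.map (substParam t (w₂.map (substParam t z))), by simp [hl₁], ?_,
    fun g g' hg hg' h h' => Option.some_injective _ ((key g hg h).trans (key g' hg' h').symm)⟩
  refine RestrictedGrowth.map_substParam ?_ (RestrictedGrowth.map_substParam ?_ hz)
  · rw [List.length_map, hl₂]
    exact hw₁
  · rwa [hlz]

/-- The Graham–Rothschild theorem, for a nonempty alphabet. -/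
theorem grahamRothschild_add {t : ℕ} (ht : 0 < t) (d : ℕ) : GrahamRothschild t (t + d) := by
  induction d generalizing t with
  | zero => exact grahamRothschild_self t
  | succ d ih =>
    refine .of_succ ht (by omega) ?_
    rw [show t + (d + 1) = t + 1 + d by omega]
    exact ih (Nat.succ_pos t)

/-- The finite dual Ramsey theorem: rigid surjections `Fin n → Fin a` are represented by the
lists of their values, which are words `RestrictedGrowth 0 w a` of length `n`. -/
theorem exists_dual_ramsey {a b : ℕ} (ha : 0 < a) (hb : 0 < b) (κ : Type) [Finite κ] :
    ∃ n : ℕ, ∀ χ : List ℕ → κ, ∃ w : List ℕ, w.length = n ∧ RestrictedGrowth 0 w b ∧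
      ∀ g g' : List ℕ, g.length = b → g'.length = b →
        RestrictedGrowth 0 g a → RestrictedGrowth 0 g' a →
          χ (w.map fun x => g.getD x 0) = χ (w.map fun x => g'.getD x 0) := by
  obtain ⟨a, rfl⟩ : ∃ d, a = 1 + d := ⟨a - 1, by omega⟩
  obtain ⟨b, rfl⟩ : ∃ D, b = 1 + D := ⟨b - 1, by omega⟩
  obtain ⟨n, h⟩ := grahamRothschild_add Nat.one_pos a b κ
  refine ⟨n + 1, fun χ => ?_⟩
  obtain ⟨w, hl, hw, hc⟩ := h fun l => χ (0 :: l)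
  have key : ∀ g : List ℕ, g.length = 1 + b → RestrictedGrowth 0 g (1 + a) →
      ∃ g', g'.length = b ∧ RestrictedGrowth 1 g' (1 + a) ∧
        (0 :: w).map (fun x => g.getD x 0) = 0 :: w.map (substParam 1 g') := by
    intro g hgl hg
    rcases g with _ | ⟨x, g⟩
    · simp at hgl; omega
    · rcases hg with hg | ⟨rfl, hg⟩
      · omega
      · refine ⟨g, by simp at hgl; omega, hg, ?_⟩
        rw [List.map_cons, List.getD_cons_zero]
        congr 1
        refine List.map_congr_left fun x _ => ?_
        rcases x with _ | x <;> simp [substParam]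
  refine ⟨0 :: w, by simp [hl], Or.inr ⟨rfl, hw⟩, fun g g' hgl hgl' hg hg' => ?_⟩
  obtain ⟨g₁, hl₁, hg₁, e₁⟩ := key g hgl hg
  obtain ⟨g₂, hl₂, hg₂, e₂⟩ := key g' hgl' hg'
  rw [e₁, e₂]
  exact hc g₁ g₂ hl₁ hl₂ hg₁ hg₂

/-! ### The special anti-lexicographic order on the relation of an `r`-erst -/

theorem altLex_iff_toColex_lt {A : Type*} [LinearOrder A] (X Y : Finset A) :
    altLex X Y ↔ toColex X < toColex Y := by
  rw [Finset.Colex.lt_iff_exists_filter_lt]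
  simp only [altLex, Finset.ext_iff, Finset.mem_filter, Finset.mem_sdiff]
  refine exists_congr fun m => ?_
  rw [and_assoc]
  refine and_congr_right fun _ => and_congr_right fun _ => forall_congr' fun z => ?_
  tauto

theorem tpRel_replicate {A : Type*} [LinearOrder A] (r : ℕ) (a : A) (i j : ℕ) :
    tpRel (List.replicate r a) i j ↔ i < r ∧ j < r := by
  simp [tpRel]

theorem tpRel_of_isChain {A : Type*} [LinearOrder A] {l : List A} (hl : l.IsChain (· < ·))
    (i j : ℕ) : tpRel l i j ↔ i ≤ j ∧ j < l.length := by
  rw [List.isChain_iff_pairwise, List.pairwise_iff_getElem] at hl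
  constructor
  · rintro ⟨hi, hj, h⟩
    refine ⟨?_, hj⟩
    by_contra! hji
    exact absurd (hl j i hj hi hji) (not_lt.2 h)
  · rintro ⟨hij, hj⟩
    refine ⟨hij.trans_lt hj, hj, ?_⟩
    rcases hij.eq_or_lt with rfl | hij
    · exact le_rfl
    · exact (hl i j _ hj hij).le

theorem card_classesOf_replicate {A : Type*} [LinearOrder A] {r : ℕ} (hr : 0 < r) (a : A) :
    (classesOf (tpRel (List.replicate r a)) r).card = 1 := by
  rw [Finset.card_eq_one]
  refine ⟨Finset.range r, ?_⟩
  have h : ∀ i ∈ Finset.range r, classOf (tpRel (List.replicate r a)) r i = Finset.range r := by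
    intro i hi
    ext j
    simp only [classOf, Finset.mem_filter, tpRel_replicate, Finset.mem_range] at hi ⊢
    tauto
  rw [classesOf, Finset.image_congr h, Finset.image_const ⟨0, Finset.mem_range.2 hr⟩]

theorem card_classesOf_of_isChain {A : Type*} [LinearOrder A] {l : List A}
    (hl : l.IsChain (· < ·)) {n : ℕ} (hn : l.length = n) : (classesOf (tpRel l) n).card = n := by
  subst hn
  have h : ∀ i ∈ Finset.range l.length, classOf (tpRel l) l.length i = {i} := by
    intro i hi
    ext j
    simp only [classOf, Finset.mem_filter, tpRel_of_isChain hl, Finset.mem_range,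
      Finset.mem_singleton] at hi ⊢
    omega
  rw [classesOf, Finset.image_congr h, Finset.card_image_of_injective _ Finset.singleton_injective,
    Finset.card_range]

theorem not_quasiLT_self (n : ℕ) (σ : ℕ → ℕ → Prop) : ¬ quasiLT n σ σ := by
  rintro (h | ⟨-, M, h, h', -⟩)
  exacts [lt_irrefl _ h, h' h]

theorem toFinset_replicate_of_pos {A : Type*} [DecidableEq A] {r : ℕ} (hr : 0 < r) (a : A) :
    (List.replicate r a).toFinset = {a} :=
  List.toFinset_replicate_of_ne_zero hr.ne'

theorem card_toFinset_of_isChain {A : Type*} [LinearOrder A] {l : List A}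
    (hl : l.IsChain (· < ·)) : l.toFinset.card = l.length :=
  List.toFinset_card_of_nodup ((List.isChain_iff_pairwise.1 hl).imp fun h => ne_of_lt h)

/-- On the relation of an `r`-erst the order `⊏_sal` compares the number of different entries, and
then the sets of entries anti-lexicographically. -/
def salKey {A : Type*} [LinearOrder A] (l : List A) : ℕ ×ₗ Colex (Finset A) :=
  toLex (l.toFinset.card, toColex l.toFinset)

theorem salLT_of_tpRel_eq {A : Type*} [LinearOrder A] {l₁ l₂ : List A}
    (hlen : l₁.length = l₂.length) (htp : tpRel l₁ = tpRel l₂)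
    (hcard : l₁.toFinset.card = l₂.toFinset.card) : salLT l₁ l₂ ↔ salKey l₁ < salKey l₂ := by
  rw [salKey, salKey, Prod.Lex.toLex_lt_toLex, salLT, htp, altLex_iff_toColex_lt]
  simp only [hlen, hcard, lt_self_iff_false, false_or, true_and, not_quasiLT_self]
  exact and_iff_right_of_imp fun h he => h.ne (by rw [he])

namespace ERstObj

variable {r : ℕ} {M N : ERstObj r}

theorem salLT_iff (hr : 2 ≤ r) {l₁ l₂ : List M.carrier} (h₁ : l₁ ∈ M.rel) (h₂ : l₂ ∈ M.rel) :
    salLT l₁ l₂ ↔ salKey l₁ < salKey l₂ := by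
  have hr0 : 0 < r := by omega
  have hlen := (M.len _ h₁).trans (M.len _ h₂).symm
  rcases M.ext l₁ h₁ with ⟨a, rfl⟩ | c₁ <;> rcases M.ext l₂ h₂ with ⟨b, rfl⟩ | c₂
  · refine salLT_of_tpRel_eq hlen ?_ ?_
    · funext i j
      simp only [tpRel_replicate]
    · simp [toFinset_replicate_of_pos hr0]
  · have hl := M.len _ h₂
    refine iff_of_true ⟨hlen, Or.inl (Or.inl ?_)⟩ ?_
    · rw [List.length_replicate, card_classesOf_replicate hr0]
      rw [card_classesOf_of_isChain c₂ hl]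
      omega
    · rw [salKey, salKey, Prod.Lex.toLex_lt_toLex, card_toFinset_of_isChain c₂,
        toFinset_replicate_of_pos hr0, Finset.card_singleton]
      exact Or.inl (by simp only; omega)
  · have hl := M.len _ h₁
    refine iff_of_false ?_ ?_
    · have e₁ := card_classesOf_of_isChain c₁ hl
      have e₂ := card_classesOf_replicate hr0 b
      rintro ⟨-, (h | ⟨h, -⟩) | ⟨h, -⟩⟩
      · rw [hl, e₁, e₂] at h
        omega
      · rw [hl, e₁, e₂] at h
        omega
      · rw [h, e₂] at e₁
        omega
    · rw [salKey, salKey, Prod.Lex.toLex_lt_toLex, card_toFinset_of_isChain c₁,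
        toFinset_replicate_of_pos hr0, Finset.card_singleton]
      rintro (h | ⟨h, -⟩) <;> simp only at h <;> omega
  · refine salLT_of_tpRel_eq hlen ?_ ?_
    · funext i j
      simp only [tpRel_of_isChain c₁, tpRel_of_isChain c₂, hlen]
    · rw [card_toFinset_of_isChain c₁, card_toFinset_of_isChain c₂, hlen]

theorem salKey_injOn (hr : 2 ≤ r) : Set.InjOn salKey M.rel := by
  have hr0 : 0 < r := by omega
  intro l₁ h₁ l₂ h₂ h
  have hf : l₁.toFinset = l₂.toFinset := congrArg (fun x => ofColex (ofLex x).2) h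
  rcases M.ext l₁ h₁ with ⟨a, rfl⟩ | c₁ <;> rcases M.ext l₂ h₂ with ⟨b, rfl⟩ | c₂
  · rw [toFinset_replicate_of_pos hr0, toFinset_replicate_of_pos hr0, Finset.singleton_inj] at hf
    rw [hf]
  · have := card_toFinset_of_isChain c₂
    rw [← hf, M.len _ h₂, toFinset_replicate_of_pos hr0, Finset.card_singleton] at this
    omega
  · have := card_toFinset_of_isChain c₁
    rw [hf, M.len _ h₁, toFinset_replicate_of_pos hr0, Finset.card_singleton] at this
    omega
  · have c₁ := List.isChain_iff_pairwise.1 c₁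
    have c₂ := List.isChain_iff_pairwise.1 c₂
    refine List.Perm.eq_of_pairwise (le := (· < ·)) (fun a b _ _ h h' => absurd h h'.asymm) c₁ c₂ ?_
    exact List.perm_of_nodup_nodup_toFinset_eq (c₁.imp ne_of_lt) (c₂.imp ne_of_lt) hf

theorem salLT_trans (hr : 2 ≤ r) {l₁ l₂ l₃ : List M.carrier} (h₁ : l₁ ∈ M.rel) (h₂ : l₂ ∈ M.rel)
    (h₃ : l₃ ∈ M.rel) (h : salLT l₁ l₂) (h' : salLT l₂ l₃) : salLT l₁ l₃ := by
  rw [salLT_iff hr h₁ h₂] at h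
  rw [salLT_iff hr h₂ h₃] at h'
  exact (salLT_iff hr h₁ h₃).2 (h.trans h')

theorem salLT_replicate (hr : 2 ≤ r) {a b : M.carrier} (h : a < b) :
    salLT (List.replicate r a) (List.replicate r b) := by
  have hr0 : 0 < r := by omega
  rw [salLT_iff hr (M.refl a) (M.refl b), salKey, salKey, toFinset_replicate_of_pos hr0,
    toFinset_replicate_of_pos hr0, Prod.Lex.toLex_lt_toLex]
  exact Or.inr ⟨by simp, Finset.Colex.singleton_lt_singleton.2 h⟩

theorem salLT_replicate_of_isChain (hr : 2 ≤ r) {a : M.carrier} {l : List M.carrier}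
    (hl : l ∈ M.rel) (h : l.IsChain (· < ·)) : salLT (List.replicate r a) l := by
  have hlen := M.len _ hl
  rw [salLT_iff hr (M.refl a) hl, salKey, salKey, toFinset_replicate_of_pos (by omega),
    Prod.Lex.toLex_lt_toLex, card_toFinset_of_isChain h, Finset.card_singleton]
  exact Or.inl (by simp only; omega)

theorem exists_replicate_of_salLT (hr : 2 ≤ r) {a : M.carrier} {l : List M.carrier}
    (hl : l ∈ M.rel) (h : salLT l (List.replicate r a)) : ∃ b, l = List.replicate r b := by
  refine (M.ext l hl).resolve_right fun hc => ?_
  rw [salLT_iff hr hl (M.refl a)] at h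
  have hlt := (salLT_iff hr (M.refl a) hl).1 (salLT_replicate_of_isChain hr hl hc)
  exact h.asymm hlt

/-- `E 0, …, E (b - 1)` is the `⊏_sal`-increasing enumeration of the relation of `M`. -/
structure IsEnum (M : ERstObj r) (E : ℕ → List M.carrier) (b : ℕ) : Prop where
  mem : ∀ j < b, E j ∈ M.rel
  exists_eq : ∀ l ∈ M.rel, ∃ j < b, E j = l
  lt_iff : ∀ i < b, ∀ j < b, salLT (E i) (E j) ↔ i < j

theorem exists_isEnum (hr : 2 ≤ r) (M : ERstObj r) : ∃ E b, IsEnum M E b := by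
  have hfin : M.rel.Finite := (List.finite_length_eq M.carrier r).subset M.len
  let K := hfin.toFinset.image salKey
  have hK : ∀ k : K, ∃ l ∈ M.rel, salKey l = k := by
    intro k
    obtain ⟨l, hl, hlk⟩ := Finset.mem_image.1 k.2
    exact ⟨l, hfin.mem_toFinset.1 hl, hlk⟩
  choose p hp hpk using hK
  let e := K.orderIsoOfFin rfl
  refine ⟨fun j => if h : j < K.card then p (e ⟨j, h⟩) else [], K.card,
    fun j hj => ?_, fun l hl => ?_, fun i hi j hj => ?_⟩
  · simp only [hj, dite_true]
    exact hp _
  · let k : K := ⟨salKey l, Finset.mem_image_of_mem _ (hfin.mem_toFinset.2 hl)⟩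
    refine ⟨e.symm k, (e.symm k).2, ?_⟩
    simp only [(e.symm k).2, dite_true, Fin.eta, e.apply_symm_apply]
    exact salKey_injOn hr (hp k) hl (hpk k)
  · simp only [hi, hj, dite_true]
    rw [salLT_iff hr (hp _) (hp _), hpk, hpk]
    exact e.lt_iff_lt.trans Fin.mk_lt_mk

theorem IsEnum.injOn {E : ℕ → List M.carrier} {b : ℕ} (hE : M.IsEnum E b) {i j : ℕ} (hi : i < b)
    (hj : j < b) (h : E i = E j) : i = j := by
  by_contra hne
  have irr : ¬ salLT (E i) (E i) := by simp [hE.lt_iff i hi i hi]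
  rcases lt_or_gt_of_ne hne with hij | hij
  · exact irr (by simpa [← h] using (hE.lt_iff i hi j hj).2 hij)
  · exact irr (by simpa [← h] using (hE.lt_iff j hj i hi).2 hij)

/-- Strong rigid quotient maps induce rigid surjections between the relations, represented by
words of restricted growth. -/
theorem IsEnum.exists_word {EM : ℕ → List M.carrier} {EN : ℕ → List N.carrier} {a b : ℕ}
    (hM : M.IsEnum EM b) (hN : N.IsEnum EN a) {f : M.carrier → N.carrier} (hf : IsSRQ M N f) :
    ∃ g : List ℕ, g.length = b ∧ RestrictedGrowth 0 g a ∧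
      ∀ j < b, EN (g.getD j 0) = (EM j).map f := by
  obtain ⟨hrel, -, hsurj, hrigid⟩ := hf
  have : ∀ j, ∃ k, j < b → k < a ∧ EN k = (EM j).map f := by
    intro j
    by_cases hj : j < b
    · obtain ⟨k, hk, hk'⟩ := hN.exists_eq _ (hrel _ (hM.mem j hj))
      exact ⟨k, fun _ => ⟨hk, hk'⟩⟩
    · exact ⟨0, fun h => absurd h hj⟩
  choose γ hγ using this
  have hγsurj : ∀ y < a, ∃ j, j < b ∧ γ j = y := by
    intro y hy
    obtain ⟨l, hl, hly⟩ := hsurj _ (hN.mem y hy)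
    obtain ⟨j, hj, rfl⟩ := hM.exists_eq l hl
    exact ⟨j, hj, hN.injOn (hγ j hj).1 hy ((hγ j hj).2.trans hly)⟩
  have hmin : ∀ y, (h : ∃ j, j < b ∧ γ j = y) →
      MinWrt salLT {u | u ∈ M.rel ∧ u.map f = EN y} (EM (Nat.find h)) := by
    intro y h
    obtain ⟨hb, hy⟩ := Nat.find_spec h
    refine ⟨⟨hM.mem _ hb, by rw [← (hγ _ hb).2, hy]⟩, ?_⟩
    rintro l ⟨hl, hly⟩
    obtain ⟨j, hj, rfl⟩ := hM.exists_eq l hl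
    have hjy : γ j = y := hN.injOn (hγ j hj).1 (hy ▸ (hγ _ hb).1) ((hγ j hj).2.trans hly)
    rcases (Nat.find_min' h ⟨hj, hjy⟩).eq_or_lt with he | hlt
    · exact Or.inl (by rw [he])
    · exact Or.inr ((hM.lt_iff _ hb _ hj).2 hlt)
  refine ⟨(List.range b).map γ, by simp, ?_, fun j hj => ?_⟩
  · refine RestrictedGrowth.of_forall_exists_lt (Nat.zero_le a) ?_ ?_ ?_
    · intro x hx
      obtain ⟨j, hj, rfl⟩ := List.mem_map.1 hx
      exact (hγ j (List.mem_range.1 hj)).1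
    · intro y _ hy
      obtain ⟨j, hj, rfl⟩ := hγsurj y hy
      exact List.mem_map.2 ⟨j, List.mem_range.2 hj, rfl⟩
    · intro i hi y _ hy
      simp only [List.length_map, List.length_range] at hi
      simp only [List.getElem_map, List.getElem_range] at hy ⊢
      have hia := (hγ i hi).1
      have hex := hγsurj y (hy.trans hia)
      have hex' : ∃ j, j < b ∧ γ j = γ i := ⟨i, hi, rfl⟩
      have := hrigid _ (hN.mem y (hy.trans hia)) _ (hN.mem _ hia)
        ((hN.lt_iff _ (hy.trans hia) _ hia).2 hy) _ _ (hmin _ hex) (hmin _ hex')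
      rw [hM.lt_iff _ (Nat.find_spec hex).1 _ (Nat.find_spec hex').1] at this
      exact ⟨Nat.find hex, this.trans_le (Nat.find_min' hex' ⟨hi, rfl⟩), (Nat.find_spec hex).2⟩
  · rw [List.getD_eq_getElem _ _ (by simpa using hj)]
    simpa using (hγ j hj).2

end ERstObj

/-! ### Maps from `r ⊗ L` determined by words -/

/-- The map on `L × {1, …, r}` that sends the `ℓ`-th block to the tuple `E (v ℓ)`. -/
def wordMap {A : Type*} [Nonempty A] {n r : ℕ} (E : ℕ → List A) (v : List ℕ)
    (x : Fin n × Fin r) : A :=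
  (E (v.getD x.1 0)).getD x.2 (Classical.arbitrary A)

theorem ofFn_wordMap {A : Type*} [Nonempty A] {n r : ℕ} {E : ℕ → List A} {v : List ℕ}
    (ℓ : Fin n) (h : (E (v.getD ℓ 0)).length = r) :
    (List.ofFn fun i : Fin r => wordMap E v (ℓ, i)) = E (v.getD ℓ 0) := by
  apply List.ext_getElem
  · rw [List.length_ofFn, h]
  · intro i h₁ h₂
    rw [List.getElem_ofFn, wordMap, List.getD_eq_getElem _ _ h₂]

namespace ERstObj

variable {r n : ℕ} {M N : ERstObj r}

theorem isSRQ_wordMap (hr : 2 ≤ r) (e : M.carrier ≃o Lex (Fin n × Fin r))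
    (he : ∀ l : List M.carrier, l ∈ M.rel ↔ l.map ⇑e ∈ rTensorRel r (Fin n))
    [Nonempty N.carrier] {E : ℕ → List N.carrier} {b : ℕ} (hE : N.IsEnum E b) {w : List ℕ}
    (hwl : w.length = n) (hw : RestrictedGrowth 0 w b) :
    IsSRQ M N fun m => wordMap E w (ofLex (e m)) := by
  set h : M.carrier → N.carrier := fun m => wordMap E w (ofLex (e m)) with hh
  let edge : Fin n → List M.carrier := fun ℓ => List.ofFn fun i : Fin r => e.symm (toLex (ℓ, i))
  have hedge : ∀ ℓ, edge ℓ ∈ M.rel := fun ℓ =>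
    (he _).2 (Or.inr ⟨ℓ, by simp [edge, List.map_ofFn, Function.comp_def]⟩)
  have hcases : ∀ l ∈ M.rel, (∃ m, l = List.replicate r m) ∨ ∃ ℓ, l = edge ℓ := by
    intro l hl
    rcases (he l).1 hl with ⟨x, hx⟩ | ⟨ℓ, hx⟩
    · refine Or.inl ⟨e.symm x, List.map_injective_iff.2 e.injective ?_⟩
      simp [hx]
    · refine Or.inr ⟨ℓ, List.map_injective_iff.2 e.injective ?_⟩
      simp [hx, edge, List.map_ofFn, Function.comp_def]
  have hlen : ∀ ℓ : Fin n, (ℓ : ℕ) < w.length := fun ℓ => hwl.symm ▸ ℓ.2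
  have hlt : ∀ ℓ : Fin n, w.getD ℓ 0 < b := by
    intro ℓ
    rw [List.getD_eq_getElem _ _ (hlen ℓ)]
    exact hw.lt_of_mem _ (List.getElem_mem _)
  have hmem : ∀ ℓ : Fin n, E (w.getD ℓ 0) ∈ N.rel := fun ℓ => hE.mem _ (hlt ℓ)
  have hmap : ∀ ℓ : Fin n, (edge ℓ).map h = E (w.getD ℓ 0) := by
    intro ℓ
    rw [← ofFn_wordMap ℓ (N.len _ (hmem ℓ)), List.map_ofFn]
    congr 1
    funext i
    simp [hh]
  have hrel : ∀ l ∈ M.rel, l.map h ∈ N.rel := by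
    intro l hl
    rcases hcases l hl with ⟨m, rfl⟩ | ⟨ℓ, rfl⟩
    · rw [List.map_replicate]
      exact N.refl _
    · rw [hmap]
      exact hmem ℓ
  have hedge_lt : ∀ j ℓ : Fin n, j < ℓ → salLT (edge j) (edge ℓ) := by
    intro j ℓ hjℓ
    have hchain : ∀ ℓ, (edge ℓ).IsChain (· < ·) := by
      intro ℓ
      rw [List.isChain_iff_pairwise, List.pairwise_ofFn]
      intro i i' hii
      rw [e.symm.lt_iff_lt, Prod.Lex.toLex_lt_toLex]
      exact Or.inr ⟨rfl, hii⟩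
    have hmem_edge : ∀ ℓ m, m ∈ (edge ℓ).toFinset ↔ (ofLex (e m)).1 = ℓ := by
      intro ℓ m
      rw [List.mem_toFinset, List.mem_ofFn]
      constructor
      · rintro ⟨i, rfl⟩
        simp
      · rintro rfl
        exact ⟨(ofLex (e m)).2, by simp⟩
    rw [salLT_iff hr (hedge j) (hedge ℓ), salKey, salKey, Prod.Lex.toLex_lt_toLex,
      ← altLex_iff_toColex_lt, card_toFinset_of_isChain (hchain j),
      card_toFinset_of_isChain (hchain ℓ)]
    refine Or.inr ⟨by simp [edge], e.symm (toLex (ℓ, ⟨r - 1, by omega⟩)), ?_, ?_, fun z hz => ?_⟩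
    · simp [hmem_edge]
    · simpa [hmem_edge] using hjℓ.ne'
    · rw [← e.lt_iff_lt, e.apply_symm_apply, Prod.Lex.lt_iff] at hz
      have hzℓ : ℓ < (ofLex (e z)).1 := by
        refine hz.resolve_right fun h => ?_
        have := (ofLex (e z)).2.2
        have := Fin.lt_def.1 h.2
        simp only [ofLex_toLex] at this
        omega
      rw [hmem_edge, hmem_edge]
      exact iff_of_false (hjℓ.trans hzℓ).ne' hzℓ.ne'
  have hprev : ∀ x ∈ N.rel, ∀ ℓ : Fin n, salLT x (E (w.getD ℓ 0)) →
      ∃ j < ℓ, E (w.getD j 0) = x := by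
    intro x hx ℓ hlt'
    obtain ⟨y, hy, rfl⟩ := hE.exists_eq x hx
    rw [hE.lt_iff _ hy _ (hlt ℓ), List.getD_eq_getElem _ _ (hlen ℓ)] at hlt'
    obtain ⟨j, hj, hjy⟩ := hw.exists_lt_getElem_eq (hlen ℓ) (Nat.zero_le _) hlt'
    refine ⟨⟨j, hj.trans ℓ.2⟩, hj, ?_⟩
    rw [List.getD_eq_getElem _ _ (hj.trans (hlen ℓ)), hjy]
  refine ⟨hrel, hrel, fun x hx => ?_, fun x hx y hy hxy a₀ b₀ ha hb => ?_⟩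
  · obtain ⟨y, hy, rfl⟩ := hE.exists_eq x hx
    obtain ⟨j, hj, hjy⟩ := List.mem_iff_getElem.1 (hw.mem (Nat.zero_le y) hy)
    refine ⟨edge ⟨j, hwl ▸ hj⟩, hedge _, ?_⟩
    rw [hmap, List.getD_eq_getElem _ _ hj, hjy]
  · suffices ∃ a' ∈ M.rel, a'.map h = x ∧ salLT a' b₀ by
      obtain ⟨a', ha', hax, hab⟩ := this
      rcases ha.2 a' ⟨ha', hax⟩ with rfl | hlt'
      · exact hab
      · exact salLT_trans hr ha.1.1 ha' hb.1.1 hlt' hab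
    obtain ⟨⟨hbM, hby⟩, -⟩ := hb
    rcases hcases b₀ hbM with ⟨m, rfl⟩ | ⟨ℓ, rfl⟩
    · rw [List.map_replicate] at hby
      subst hby
      obtain ⟨c, rfl⟩ := exists_replicate_of_salLT hr hx hxy
      obtain ⟨⟨ℓ, i⟩, hm⟩ : ∃ p : Fin n × Fin r, e m = toLex p := ⟨ofLex (e m), rfl⟩
      have hmE : h m ∈ E (w.getD ℓ 0) := by
        rw [← hmap ℓ]
        refine List.mem_map_of_mem (List.mem_ofFn.2 ⟨i, ?_⟩)
        rw [← hm, e.symm_apply_apply]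
      have hxE : salLT (List.replicate r c) (E (w.getD ℓ 0)) := by
        rcases N.ext _ (hmem ℓ) with ⟨d, hd⟩ | hd
        · rw [hd] at hmE ⊢
          rwa [List.eq_of_mem_replicate hmE] at hxy
        · exact salLT_replicate_of_isChain hr (hmem ℓ) hd
      obtain ⟨j, hj, hjx⟩ := hprev _ hx ℓ hxE
      let m' := e.symm (toLex (j, ⟨0, by omega⟩))
      refine ⟨List.replicate r m', M.refl _, ?_, salLT_replicate hr ?_⟩
      · rw [List.map_replicate]
        have : h m' ∈ List.replicate r c := by
          rw [← hjx, ← hmap j]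
          exact List.mem_map_of_mem (List.mem_ofFn.2 ⟨_, rfl⟩)
        rw [List.eq_of_mem_replicate this]
      · rw [← e.lt_iff_lt, hm, e.apply_symm_apply, Prod.Lex.toLex_lt_toLex]
        exact Or.inl hj
    · rw [hmap] at hby
      subst hby
      obtain ⟨j, hj, hjx⟩ := hprev x hx ℓ hxy
      exact ⟨edge j, hedge j, (hmap j).trans hjx, hedge_lt j ℓ hj⟩

end ERstObj

/-! ### The dual Ramsey property -/

namespace ERstObj

variable {r : ℕ}

theorem isSRQ_id (M : ERstObj r) [IsEmpty M.carrier] (hr : 0 < r) : IsSRQ M M id := by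
  have hrel : ∀ l, l ∉ M.rel := by
    rintro (_ | ⟨m, -⟩) hl
    · exact hr.ne (M.len _ hl)
    · exact isEmptyElim m
  exact ⟨fun l hl => absurd hl (hrel l), fun l hl => absurd hl (hrel l),
    fun l hl => absurd hl (hrel l), fun x hx => absurd hx (hrel x)⟩

theorem IsEnum.pos {M : ERstObj r} [Nonempty M.carrier] {E : ℕ → List M.carrier} {b : ℕ}
    (hE : M.IsEnum E b) : 0 < b := by
  obtain ⟨j, hj, -⟩ := hE.exists_eq _ (M.refl (Classical.arbitrary M.carrier))
  exact (Nat.zero_le j).trans_lt hj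

theorem nonempty_of_isSRQ {M N : ERstObj r} (hr : 0 < r) [Nonempty N.carrier]
    {f : M.carrier → N.carrier} (hf : IsSRQ M N f) : Nonempty M.carrier := by
  obtain ⟨l, hl, -⟩ := hf.2.2.1 _ (N.refl (Classical.arbitrary N.carrier))
  exact ⟨l.get ⟨0, (M.len l hl).symm ▸ hr⟩⟩

/-- Composing a map given by a word with a strong rigid quotient map amounts to substituting the
letters of the word. -/
theorem comp_wordMap {M N : ERstObj r} [Nonempty M.carrier] [Nonempty N.carrier] {b n : ℕ}
    {EM : ℕ → List M.carrier} {EN : ℕ → List N.carrier} (hM : M.IsEnum EM b)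
    {f : M.carrier → N.carrier} {γ w : List ℕ} (hγ : ∀ j < b, EN (γ.getD j 0) = (EM j).map f)
    (hwl : w.length = n) (hw : RestrictedGrowth 0 w b) (x : Fin n × Fin r) :
    f (wordMap EM w x) = wordMap EN (w.map fun y => γ.getD y 0) x := by
  obtain ⟨ℓ, i⟩ := x
  have hℓ : (ℓ : ℕ) < w.length := hwl.symm ▸ ℓ.2
  have hb : w[(ℓ : ℕ)] < b := hw.lt_of_mem _ (List.getElem_mem _)
  have hi : (i : ℕ) < (EM w[(ℓ : ℕ)]).length := (M.len _ (hM.mem _ hb)).symm ▸ i.2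
  have hwγ : (w.map fun y => γ.getD y 0).getD ℓ 0 = γ.getD w[(ℓ : ℕ)] 0 := by
    rw [List.getD_eq_getElem _ _ (by rwa [List.length_map]), List.getElem_map]
  rw [wordMap, wordMap, hwγ, hγ _ hb, List.getD_eq_getElem _ _ hℓ, List.getD_eq_getElem _ _ hi,
    List.getD_eq_getElem ((EM w[(ℓ : ℕ)]).map f) _ (by rwa [List.length_map]), List.getElem_map]

theorem hasDualRamseySub (hr : 2 ≤ r) (S : Set (ERstObj r))
    (hS : ∀ (L : Type) [Fintype L] [LinearOrder L],
      ∃ M ∈ S, ∃ e : M.carrier ≃o Lex (L × Fin r),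
        ∀ l : List M.carrier, l ∈ M.rel ↔ l.map ⇑e ∈ rTensorRel r L) :
    HasDualRamseySub (fun M : ERstObj r => M.carrier) IsSRQ S := by
  have hr0 : 0 < r := by omega
  rintro k hk A - B hB ⟨f₀, hf₀⟩
  rcases isEmpty_or_nonempty A.carrier with hA | hA
  · have hBe : IsEmpty B.carrier := f₀.isEmpty
    exact ⟨B, hB, fun χ => ⟨id, isSRQ_id B hr0, χ f₀,
      fun g _ => congrArg χ (funext fun m => isEmptyElim m)⟩⟩
  · have hBn := nonempty_of_isSRQ hr0 hf₀
    obtain ⟨EA, a, hEA⟩ := exists_isEnum hr A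
    obtain ⟨EB, b, hEB⟩ := exists_isEnum hr B
    obtain ⟨n, hn⟩ := exists_dual_ramsey hEA.pos hEB.pos (Fin k)
    obtain ⟨M, hM, e, he⟩ := hS (Fin n)
    refine ⟨M, hM, fun χ => ?_⟩
    obtain ⟨w, hwl, hw, hχ⟩ := hn fun v => χ fun m => wordMap EA v (ofLex (e m))
    refine ⟨_, isSRQ_wordMap hr e he hEB hwl hw, ?_⟩
    obtain ⟨γ₀, hγ₀l, hγ₀, -⟩ := hEB.exists_word hEA hf₀
    refine ⟨χ fun m => wordMap EA (w.map fun y => γ₀.getD y 0) (ofLex (e m)), fun g hg => ?_⟩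
    obtain ⟨γ, hγl, hγ, hγg⟩ := hEB.exists_word hEA hg
    rw [← hχ γ γ₀ hγl hγ₀l hγ hγ₀]
    exact congrArg χ (funext fun m => comp_wordMap hEB hγg hwl hw _)

/-- The `r`-erst `r ⊗ L`. -/
def tensor (r : ℕ) (L : Type) [Fintype L] [LinearOrder L] : ERstObj r where
  carrier := Lex (L × Fin r)
  fintypeI := inferInstanceAs (Fintype (L × Fin r))
  rel := rTensorRel r L
  len := by
    rintro l (⟨x, rfl⟩ | ⟨x, rfl⟩) <;> simp
  refl x := Or.inl ⟨x, rfl⟩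
  ext := by
    rintro l (h | ⟨x, rfl⟩)
    · exact Or.inl h
    · refine Or.inr (List.isChain_iff_pairwise.2 (List.pairwise_ofFn.2 fun i j hij => ?_))
      exact Prod.Lex.toLex_lt_toLex.2 (Or.inr ⟨rfl, hij⟩)

end ERstObj

/-- Theorem 5.4. Let `r ≥ 2`. Every full subcategory `C` of
`ERst_srq(r)` such that for every finite chain `L` there is an object of `C`
isomorphic to `r ⊗ L` has the dual Ramsey property. In particular, `ERst_srq(r)`
itself has the dual Ramsey property. -/
theorem stmt13 (r : ℕ) (hr : 2 ≤ r) :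
    (∀ S : Set (ERstObj r),
      (∀ (L : Type) [Fintype L] [LinearOrder L],
        ∃ M ∈ S, ∃ e : M.carrier ≃o Lex (L × Fin r),
          ∀ l : List M.carrier, l ∈ M.rel ↔ l.map ⇑e ∈ rTensorRel r L) →
      HasDualRamseySub (fun M : ERstObj r => M.carrier) IsSRQ S)
    ∧ HasDualRamseyClass (fun M : ERstObj r => M.carrier) IsSRQ := by
  refine ⟨ERstObj.hasDualRamseySub hr, ERstObj.hasDualRamseySub hr _ fun L _ _ => ?_⟩
  exact ⟨ERstObj.tensor r L, Set.mem_univ _, OrderIso.refl _, fun l =>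
    iff_of_eq (congrArg (· ∈ rTensorRel r L) (List.map_id l).symm)⟩
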